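/- The moment sequence satisfies η₀ = 1 - e·E₁(1), and for every integer n ≥ 1, η_n = (e·(n+1)·E_n(1) - 1)·(n-1)!, where E_n(1) = ∫₁^∞ e^{-t} t^{-n} dt. -/

import Mathlib

open MeasureTheory

/-- The moment sequence of the Hörmander-Fock space. -/
noncomputable def eta (n : ℕ) : ℝ :=
  ∫ t in Set.Ioi (0 : ℝ), t ^ n / (1 + t) ^ 2 * Real.exp (-t)

/-- The exponential integral function at `1`: `Eₘ(1) = ∫₁^∞ e^{-t} t^{-m} dt`. -/
noncomputable def expInt (m : ℕ) : ℝ :=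
  ∫ t in Set.Ioi (1 : ℝ), Real.exp (-t) / t ^ m

theorem integrableOn_pow_mul_exp_neg (n : ℕ) :
    IntegrableOn (fun t : ℝ => t ^ n * Real.exp (-t)) (Set.Ioi 0) := by
  have h := Real.GammaIntegral_convergent (s := (n : ℝ) + 1) (by positivity)
  refine h.congr_fun (fun t _ => ?_) measurableSet_Ioi
  simp [mul_comm]

theorem integral_pow_mul_exp_neg (n : ℕ) :
    ∫ t in Set.Ioi (0 : ℝ), t ^ n * Real.exp (-t) = n.factorial := by
  rw [← Real.Gamma_nat_eq_factorial, Real.Gamma_eq_integral (by positivity)]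
  refine setIntegral_congr_fun measurableSet_Ioi fun t _ => ?_
  simp [mul_comm]

theorem integrableOn_eta (n : ℕ) :
    IntegrableOn (fun t : ℝ => t ^ n / (1 + t) ^ 2 * Real.exp (-t)) (Set.Ioi 0) := by
  refine Integrable.mono' (integrableOn_pow_mul_exp_neg n)
    (Measurable.aestronglyMeasurable (by fun_prop)) ?_
  filter_upwards [ae_restrict_mem measurableSet_Ioi] with t ht
  have ht : 0 < t := ht
  rw [Real.norm_of_nonneg (by positivity)]
  gcongr
  exact div_le_self (by positivity) (one_le_pow₀ (by linarith))

theorem integrableOn_expInt (m : ℕ) :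
    IntegrableOn (fun t : ℝ => Real.exp (-t) / t ^ m) (Set.Ioi 1) := by
  refine Integrable.mono' (integrableOn_exp_neg_Ioi 1)
    (Measurable.aestronglyMeasurable (by fun_prop)) ?_
  filter_upwards [ae_restrict_mem measurableSet_Ioi] with t ht
  have ht : 1 < t := ht
  rw [Real.norm_of_nonneg (by positivity)]
  exact div_le_self (Real.exp_pos _).le (one_le_pow₀ ht.le)

theorem eta_add_two (n : ℕ) : eta (n + 2) + 2 * eta (n + 1) + eta n = n.factorial := by
  have h1 := (integrableOn_eta (n + 1)).const_mul 2
  have h2 : IntegrableOn (fun t : ℝ => t ^ (n + 2) / (1 + t) ^ 2 * Real.exp (-t) +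
      2 * (t ^ (n + 1) / (1 + t) ^ 2 * Real.exp (-t))) (Set.Ioi 0) :=
    (integrableOn_eta (n + 2)).add h1
  rw [← integral_pow_mul_exp_neg, eta, eta, eta, ← integral_const_mul,
    ← integral_add (integrableOn_eta _) h1, ← integral_add h2 (integrableOn_eta _)]
  refine setIntegral_congr_fun measurableSet_Ioi fun t ht => ?_
  have ht : 0 < t := ht
  have : 1 + t ≠ 0 := by positivity
  field_simp
  ring

theorem mul_expInt_succ (m : ℕ) : m * expInt (m + 1) = Real.exp (-1) - expInt m := by
  have hderiv : ∀ x ∈ Set.Ici (1 : ℝ), HasDerivAt (fun t : ℝ => Real.exp (-t) / t ^ m)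
      (-(m * (Real.exp (-x) / x ^ (m + 1)) + Real.exp (-x) / x ^ m)) x := by
    intro x hx
    have hx : 0 < x := lt_of_lt_of_le one_pos hx
    refine ((hasDerivAt_neg x).exp.fun_div (hasDerivAt_pow m x) (by positivity)).congr_deriv ?_
    rcases m with _ | m
    · simp
    · simp only [Nat.add_sub_cancel]
      field_simp
      ring
  have hlim : Filter.Tendsto (fun t : ℝ => Real.exp (-t) / t ^ m) Filter.atTop (nhds 0) := by
    refine squeeze_zero' ?_ ?_ Real.tendsto_exp_neg_atTop_nhds_zero
    · filter_upwards [Filter.eventually_ge_atTop 1] with t ht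
      positivity
    · filter_upwards [Filter.eventually_ge_atTop 1] with t ht
      exact div_le_self (Real.exp_pos _).le (one_le_pow₀ ht)
  have h1 := (integrableOn_expInt (m + 1)).const_mul (m : ℝ)
  have h := integral_Ioi_of_hasDerivAt_of_tendsto' hderiv
    (h1.add (integrableOn_expInt m)).neg hlim
  rw [integral_neg, integral_add h1 (integrableOn_expInt m), integral_const_mul] at h
  simp only [one_pow, div_one] at h
  rw [expInt, expInt]
  linarith

theorem exp_mul_expInt_succ (m : ℕ) :
    m * (Real.exp 1 * expInt (m + 1)) = 1 - Real.exp 1 * expInt m := by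
  rw [mul_left_comm, mul_expInt_succ, mul_sub, ← Real.exp_add]
  simp

theorem setIntegral_Ioi_zero_comp_one_add (f : ℝ → ℝ) :
    ∫ t in Set.Ioi (0 : ℝ), f (1 + t) = ∫ t in Set.Ioi (1 : ℝ), f t := by
  rw [← (measurePreserving_add_left volume (1 : ℝ)).setIntegral_preimage_emb
    (measurableEmbedding_addLeft 1) f (Set.Ioi 1)]
  simp

theorem eta_zero : eta 0 = Real.exp 1 * expInt 2 := by
  rw [expInt, ← setIntegral_Ioi_zero_comp_one_add, ← integral_const_mul, eta]
  refine setIntegral_congr_fun measurableSet_Ioi fun t _ => ?_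
  have h : Real.exp (-t) = Real.exp 1 * Real.exp (-(1 + t)) := by
    rw [← Real.exp_add]; ring_nf
  simp only [h]
  ring

theorem eta_zero_add_eta_one : eta 0 + eta 1 = Real.exp 1 * expInt 1 := by
  rw [expInt, ← setIntegral_Ioi_zero_comp_one_add, ← integral_const_mul, eta, eta,
    ← integral_add (integrableOn_eta _) (integrableOn_eta _)]
  refine setIntegral_congr_fun measurableSet_Ioi fun t ht => ?_
  have ht : 0 < t := ht
  have h : Real.exp (-t) = Real.exp 1 * Real.exp (-(1 + t)) := by
    rw [← Real.exp_add]; ring_nf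
  have : 1 + t ≠ 0 := by positivity
  simp only [h]
  field_simp

theorem eta_zero_eq : eta 0 = 1 - Real.exp 1 * expInt 1 := by
  have h := exp_mul_expInt_succ 1
  rw [eta_zero]
  simpa using h

theorem eta_succ (n : ℕ) :
    eta (n + 1) = (Real.exp 1 * (n + 2) * expInt (n + 1) - 1) * n.factorial := by
  induction n using Nat.twoStepInduction with
  | zero =>
    have h := eta_zero_add_eta_one
    rw [eta_zero_eq] at h
    simp only [Nat.factorial_zero, Nat.cast_zero, Nat.cast_one]
    linarith
  | one =>
    have h0 := eta_add_two 0
    have h1 := eta_zero_add_eta_one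
    have h2 := exp_mul_expInt_succ 1
    have h3 := eta_zero_eq
    norm_num at h0 h2 ⊢
    linarith
  | more n ih0 ih1 =>
    have h := eta_add_two (n + 1)
    have h1 := exp_mul_expInt_succ (n + 1)
    have h2 := exp_mul_expInt_succ (n + 2)
    rw [ih0, ih1] at h
    simp only [Nat.factorial_succ] at h ⊢
    push_cast at h h1 h2 ⊢
    linear_combination h - (n + 4) * (n + 1) * (n.factorial : ℝ) * h2
      - (n + 2) * (n.factorial : ℝ) * h1

theorem stmt_8 :
    eta 0 = 1 - Real.exp 1 * expInt 1 ∧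
      ∀ n : ℕ, 1 ≤ n →
        eta n = (Real.exp 1 * (n + 1) * expInt n - 1) * (n - 1).factorial := by
  refine ⟨eta_zero_eq, fun n hn => ?_⟩
  obtain ⟨k, rfl⟩ := Nat.exists_eq_add_of_le' hn
  rw [eta_succ, Nat.add_sub_cancel]
  push_cast
  ring
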